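/- (Spherical case, normal-vector characterization.) Let γ(t) = Ψ(u(t), v(t)) be a nondegenerate curve on [a,b] with sinh(u(t)) > 0 and sinh(u(t)) + λ ≠ 0 for all t. Then γ is a critical point of the energy with density ρ(u,v) = sinh(u) + λ (a catenary with respect to the plane {z = 0}) if and only if its geodesic curvature satisfies κ(t) = ⟨n(t), Z⟩ / ( d(t) + λ ) for all t, where Z = (0,0,1), n is the principal normal of γ, and d(t) = sinh(u(t)) is the Lorentzian distance from γ(t) to the plane {z = 0}. -/

import Mathlib

noncomputable section

open Real

/-- Lorentzian inner product on `ℝ³`: `⟨p,q⟩ = p₁q₁ + p₂q₂ − p₃q₃`. -/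
def lprod (p q : Fin 3 → ℝ) : ℝ := p 0 * q 0 + p 1 * q 1 - p 2 * q 2

/-- Determinant of the 3×3 matrix with rows `a`, `b`, `c`. -/
def det3 (a b c : Fin 3 → ℝ) : ℝ :=
  a 0 * (b 1 * c 2 - b 2 * c 1) - a 1 * (b 0 * c 2 - b 2 * c 0)
    + a 2 * (b 0 * c 1 - b 1 * c 0)

/-- Parametrization `Ψ` of the de Sitter plane `S₁² ⊂ L³`. -/
def Psi (u v : ℝ) : Fin 3 → ℝ :=
  ![Real.cosh u * Real.cos v, Real.cosh u * Real.sin v, Real.sinh u]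

/-- Lorentzian cross product, characterized by `lprod (lcross a b) c = det3 a b c`. -/
def lcross (a b : Fin 3 → ℝ) : Fin 3 → ℝ :=
  ![a 1 * b 2 - a 2 * b 1, a 2 * b 0 - a 0 * b 2, a 1 * b 0 - a 0 * b 1]

/-- The curve `t ↦ Ψ(u t, v t)`, restricted to `[a, b]`, is a critical point of the
energy `E[γ] = ∫ₐᵇ ρ(u(t), v(t)) |γ'(t)| dt` among variations fixing the endpoints. -/
def IsCritical (ρ : ℝ → ℝ → ℝ) (ε : ℝ) (u v : ℝ → ℝ) (a b : ℝ) : Prop :=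
  ∀ φ ψ : ℝ → ℝ, ContDiff ℝ (⊤ : ℕ∞) φ → ContDiff ℝ (⊤ : ℕ∞) ψ →
    φ a = 0 → φ b = 0 → ψ a = 0 → ψ b = 0 →
    deriv (fun s : ℝ => ∫ t in a..b,
      ρ (u t + s * φ t) (v t + s * ψ t) *
        Real.sqrt (ε * ((deriv v t + s * deriv ψ t) ^ 2 *
          Real.cosh (u t + s * φ t) ^ 2 - (deriv u t + s * deriv φ t) ^ 2))) 0 = 0

open Topology Set in
/-- Differentiation at `0` under an interval integral, when the integrand and its derivative in the
parameter are continuous on an open neighbourhood of `{0} × [a, b]`. -/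
theorem hasDerivAt_intervalIntegral_of_continuousOn {a b : ℝ} (hab : a ≤ b) {F F' : ℝ → ℝ → ℝ}
    {O : Set (ℝ × ℝ)} (hO : IsOpen O) (hsub : ∀ t ∈ Icc a b, ((0 : ℝ), t) ∈ O)
    (hF : ContinuousOn (fun p : ℝ × ℝ => F p.1 p.2) O)
    (hF' : ContinuousOn (fun p : ℝ × ℝ => F' p.1 p.2) O)
    (hderiv : ∀ p ∈ O, HasDerivAt (fun s => F s p.2) (F' p.1 p.2) p.1) :
    HasDerivAt (fun s => ∫ t in a..b, F s t) (∫ t in a..b, F' 0 t) 0 := by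
  obtain ⟨U, V, hU, -, hU0, hV, hUV⟩ := generalized_tube_lemma (isCompact_singleton (x := (0 : ℝ)))
    (isCompact_Icc (a := a) (b := b)) hO (by
      rintro ⟨s, t⟩ ⟨hs, ht⟩
      obtain rfl : s = 0 := hs
      exact hsub t ht)
  obtain ⟨δ, hδ, hball⟩ := Metric.nhds_basis_closedBall.mem_iff.1
    (hU.mem_nhds (hU0 (mem_singleton 0)))
  have hmem : ∀ s ∈ Metric.closedBall (0 : ℝ) δ, ∀ t ∈ Icc a b, (s, t) ∈ O :=
    fun s hs t ht => hUV ⟨hball hs, hV ht⟩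
  have hslice : ∀ {f : ℝ → ℝ → ℝ}, ContinuousOn (fun p : ℝ × ℝ => f p.1 p.2) O →
      ∀ s ∈ Metric.closedBall (0 : ℝ) δ, ContinuousOn (f s) (Icc a b) := fun hf s hs =>
    hf.comp (by fun_prop : ContinuousOn (fun t : ℝ => (s, t)) (Icc a b)) (hmem s hs)
  have hmeas : ∀ {f : ℝ → ℝ}, ContinuousOn f (Icc a b) →
      MeasureTheory.AEStronglyMeasurable f (MeasureTheory.volume.restrict (uIoc a b)) := by
    intro f hf
    rw [uIoc_of_le hab]
    exact (hf.mono Ioc_subset_Icc_self).aestronglyMeasurable measurableSet_Ioc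
  have h0 : (0 : ℝ) ∈ Metric.closedBall (0 : ℝ) δ := Metric.mem_closedBall_self hδ.le
  obtain ⟨C, hC⟩ := ((isCompact_closedBall (0 : ℝ) δ).prod
    (isCompact_Icc (a := a) (b := b))).exists_bound_of_continuousOn
      (hF'.mono fun p hp => hmem p.1 hp.1 p.2 hp.2)
  have hIcc : ∀ {t}, t ∈ uIoc a b → t ∈ Icc a b := fun ht => by
    rw [uIoc_of_le hab] at ht
    exact Ioc_subset_Icc_self ht
  refine (intervalIntegral.hasDerivAt_integral_of_dominated_loc_of_deriv_le (bound := fun _ => C)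
    (Metric.closedBall_mem_nhds 0 hδ) ?_ ?_ (hmeas (hslice hF' 0 h0)) ?_
    intervalIntegrable_const ?_).2
  · filter_upwards [Metric.closedBall_mem_nhds 0 hδ] with s hs
    exact hmeas (hslice hF s hs)
  · exact (hslice hF 0 h0).intervalIntegrable_of_Icc hab
  · exact .of_forall fun t ht s hs => hC (s, t) ⟨hs, hIcc ht⟩
  · exact .of_forall fun t ht s hs => hderiv (s, t) (hmem s hs t (hIcc ht))

/-- The Euler–Lagrange expression of the energy with density `sinh u + lam`, up to positive
factors. -/
def catenaryResidue (lam : ℝ) (u v : ℝ → ℝ) (t : ℝ) : ℝ :=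
  cosh (u t) ^ 2 * deriv v t * (deriv v t ^ 2 * cosh (u t) ^ 2 - deriv u t ^ 2) -
    (sinh (u t) + lam) *
      (cosh (u t) * (deriv u t * deriv (deriv v) t - deriv v t * deriv (deriv u) t) +
        2 * deriv u t ^ 2 * deriv v t * sinh (u t) -
        deriv v t ^ 3 * sinh (u t) * cosh (u t) ^ 2)

theorem contDiff_deriv_of_contDiff_top {f : ℝ → ℝ} (hf : ContDiff ℝ (⊤ : ℕ∞) f) :
    ContDiff ℝ (⊤ : ℕ∞) (deriv f) :=
  (contDiff_infty_iff_deriv.1 hf).2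

theorem hasDerivAt_of_contDiff_top {f : ℝ → ℝ} (hf : ContDiff ℝ (⊤ : ℕ∞) f) (t : ℝ) :
    HasDerivAt f (deriv f t) t :=
  ((contDiff_infty_iff_deriv.1 hf).1 t).hasDerivAt

theorem contDiff_catenaryResidue (lam : ℝ) {u v : ℝ → ℝ} (hu : ContDiff ℝ (⊤ : ℕ∞) u)
    (hv : ContDiff ℝ (⊤ : ℕ∞) v) : ContDiff ℝ (⊤ : ℕ∞) (catenaryResidue lam u v) := by
  have hu1 := contDiff_deriv_of_contDiff_top hu
  have hv1 := contDiff_deriv_of_contDiff_top hv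
  have hu2 := contDiff_deriv_of_contDiff_top hu1
  have hv2 := contDiff_deriv_of_contDiff_top hv1
  unfold catenaryResidue
  fun_prop

open Set in
/-- First variation of the energy with density `sinh u + lam`. -/
theorem hasDerivAt_catenary_energy {a b lam ε : ℝ} (hab : a < b) {u v : ℝ → ℝ}
    (hu : ContDiff ℝ (⊤ : ℕ∞) u) (hv : ContDiff ℝ (⊤ : ℕ∞) v) (hε : ε = 1 ∨ ε = -1)
    (hnd : ∀ t ∈ Icc a b, 0 < ε * (deriv v t ^ 2 * cosh (u t) ^ 2 - deriv u t ^ 2))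
    {φ ψ : ℝ → ℝ} (hφ : ContDiff ℝ (⊤ : ℕ∞) φ) (hψ : ContDiff ℝ (⊤ : ℕ∞) ψ)
    (hφa : φ a = 0) (hφb : φ b = 0) (hψa : ψ a = 0) (hψb : ψ b = 0) :
    HasDerivAt (fun s : ℝ => ∫ t in a..b, (sinh (u t + s * φ t) + lam) *
      √(ε * ((deriv v t + s * deriv ψ t) ^ 2 * cosh (u t + s * φ t) ^ 2 -
        (deriv u t + s * deriv φ t) ^ 2)))
      (∫ t in a..b, cosh (u t) * catenaryResidue lam u v t *
        (deriv v t * φ t - deriv u t * ψ t) /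
          √(ε * (deriv v t ^ 2 * cosh (u t) ^ 2 - deriv u t ^ 2)) ^ 3) 0 := by
  have hu1 := contDiff_deriv_of_contDiff_top hu
  have hv1 := contDiff_deriv_of_contDiff_top hv
  have hu2 := contDiff_deriv_of_contDiff_top hu1
  have hv2 := contDiff_deriv_of_contDiff_top hv1
  have hφ1 := contDiff_deriv_of_contDiff_top hφ
  have hψ1 := contDiff_deriv_of_contDiff_top hψ
  have cu := hu.continuous
  have cu1 := hu1.continuous
  have cv1 := hv1.continuous
  have cu2 := hu2.continuous
  have cv2 := hv2.continuous
  have cφ := hφ.continuous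
  have cψ := hψ.continuous
  have cφ1 := hφ1.continuous
  have cψ1 := hψ1.continuous
  have cG := (contDiff_catenaryResidue lam hu hv).continuous
  let Q : ℝ × ℝ → ℝ := fun p => ε * ((deriv v p.2 + p.1 * deriv ψ p.2) ^ 2 *
    cosh (u p.2 + p.1 * φ p.2) ^ 2 - (deriv u p.2 + p.1 * deriv φ p.2) ^ 2)
  let Q' : ℝ × ℝ → ℝ := fun p => ε * (2 * (deriv v p.2 + p.1 * deriv ψ p.2) * deriv ψ p.2 *
    cosh (u p.2 + p.1 * φ p.2) ^ 2 + (deriv v p.2 + p.1 * deriv ψ p.2) ^ 2 *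
    (2 * cosh (u p.2 + p.1 * φ p.2) * (sinh (u p.2 + p.1 * φ p.2) * φ p.2)) -
    2 * (deriv u p.2 + p.1 * deriv φ p.2) * deriv φ p.2)
  have cQ : Continuous Q := by unfold Q; fun_prop
  have cQ' : Continuous Q' := by unfold Q'; fun_prop
  let F' : ℝ → ℝ → ℝ := fun s t => cosh (u t + s * φ t) * φ t * √(Q (s, t)) +
    (sinh (u t + s * φ t) + lam) * (Q' (s, t) / (2 * √(Q (s, t))))
  have key := hasDerivAt_intervalIntegral_of_continuousOn hab.le
    (F := fun s t => (sinh (u t + s * φ t) + lam) * √(Q (s, t))) (F' := F')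
    (O := {p | 0 < Q p}) (isOpen_lt continuous_const cQ)
    (fun t ht => by simpa [Q] using hnd t ht) (by fun_prop)
    (by
      have h0 : ∀ p ∈ {p | 0 < Q p}, 2 * √(Q p) ≠ 0 := fun p hp =>
        mul_ne_zero two_ne_zero (Real.sqrt_pos.2 hp).ne'
      unfold F'
      fun_prop (disch := assumption))
    (by
      rintro ⟨s, t⟩ hp
      have hp : 0 < Q (s, t) := hp
      have lin : ∀ x y : ℝ, HasDerivAt (fun s : ℝ => x + s * y) y s := fun x y => by
        simpa using ((hasDerivAt_id s).mul_const y).const_add x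
      have hQ : HasDerivAt (fun s => Q (s, t)) (Q' (s, t)) s := by
        have := ((((lin (deriv v t) (deriv ψ t)).pow 2).mul ((lin (u t) (φ t)).cosh.pow 2)).sub
          ((lin (deriv u t) (deriv φ t)).pow 2)).const_mul ε
        exact this.congr_deriv (by simp [Q'])
      exact ((lin (u t) (φ t)).sinh.add_const lam).mul (hQ.sqrt hp.ne'))
  let Q0 : ℝ → ℝ := fun t => ε * (deriv v t ^ 2 * cosh (u t) ^ 2 - deriv u t ^ 2)
  let Q0' : ℝ → ℝ := fun t => ε * (2 * deriv v t * deriv (deriv v) t * cosh (u t) ^ 2 +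
    deriv v t ^ 2 * (2 * cosh (u t) * (sinh (u t) * deriv u t)) -
    2 * deriv u t * deriv (deriv u) t)
  let N : ℝ → ℝ := fun t => ε * (sinh (u t) + lam) *
    (deriv v t * cosh (u t) ^ 2 * ψ t - deriv u t * φ t)
  let N' : ℝ → ℝ := fun t => ε * (cosh (u t) * deriv u t) *
      (deriv v t * cosh (u t) ^ 2 * ψ t - deriv u t * φ t) + ε * (sinh (u t) + lam) *
      ((deriv (deriv v) t * cosh (u t) ^ 2 +
        deriv v t * (2 * cosh (u t) * (sinh (u t) * deriv u t))) * ψ t +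
        deriv v t * cosh (u t) ^ 2 * deriv ψ t -
        (deriv (deriv u) t * φ t + deriv u t * deriv φ t))
  have hQ0pos : ∀ t ∈ Icc a b, 0 < Q0 t := hnd
  have hr : ∀ t ∈ Icc a b, √(Q0 t) ≠ 0 := fun t ht => (Real.sqrt_pos.2 (hnd t ht)).ne'
  have cQ0 : Continuous Q0 := by unfold Q0; fun_prop
  have cQ0' : Continuous Q0' := by unfold Q0'; fun_prop
  have cN : Continuous N := by unfold N; fun_prop
  have cN' : Continuous N' := by unfold N'; fun_prop
  let H' : ℝ → ℝ := fun t => (N' t * √(Q0 t) - N t * (Q0' t / (2 * √(Q0 t)))) / √(Q0 t) ^ 2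
  have hH : ∀ t ∈ Icc a b, HasDerivAt (fun t => N t / √(Q0 t)) (H' t) t := by
    intro t ht
    have du := hasDerivAt_of_contDiff_top hu t
    have du1 := hasDerivAt_of_contDiff_top hu1 t
    have dv1 := hasDerivAt_of_contDiff_top hv1 t
    have dφ := hasDerivAt_of_contDiff_top hφ t
    have dψ := hasDerivAt_of_contDiff_top hψ t
    have dQ : HasDerivAt Q0 (Q0' t) t := by
      have := (((dv1.pow 2).mul (du.cosh.pow 2)).sub (du1.pow 2)).const_mul ε
      exact this.congr_deriv (by simp [Q0'])
    have dN : HasDerivAt N (N' t) t := by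
      have := ((du.sinh.add_const lam).const_mul ε).mul
        (((dv1.mul (du.cosh.pow 2)).mul dψ).sub (du1.mul dφ))
      exact this.congr_deriv (by simp [N'])
    exact dN.div (dQ.sqrt (hQ0pos t ht).ne') (hr t ht)
  have cH' : ContinuousOn H' (Icc a b) := by
    have h2 : ∀ t ∈ Icc a b, 2 * √(Q0 t) ≠ 0 := fun t ht => mul_ne_zero two_ne_zero (hr t ht)
    have h3 : ∀ t ∈ Icc a b, √(Q0 t) ^ 2 ≠ 0 := fun t ht => pow_ne_zero 2 (hr t ht)
    unfold H'
    fun_prop (disch := assumption)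
  have iH' : ∫ t in a..b, H' t = 0 := by
    rw [intervalIntegral.integral_eq_sub_of_hasDerivAt (f := fun t => N t / √(Q0 t))
      (fun t ht => hH t (by rwa [uIcc_of_le hab.le] at ht)) (cH'.intervalIntegrable_of_Icc hab.le)]
    simp [N, hφa, hφb, hψa, hψb]
  let E : ℝ → ℝ := fun t => cosh (u t) * catenaryResidue lam u v t *
        (deriv v t * φ t - deriv u t * ψ t) / √(Q0 t) ^ 3
  have cE : ContinuousOn E (Icc a b) := by
    have h3 : ∀ t ∈ Icc a b, √(Q0 t) ^ 3 ≠ 0 := fun t ht => pow_ne_zero 3 (hr t ht)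
    unfold E
    fun_prop (disch := assumption)
  have hsplit : ∀ t ∈ Icc a b, F' 0 t = E t + H' t := by
    intro t ht
    have hr0 := hr t ht
    have hsq : √(Q0 t) ^ 2 = Q0 t := Real.sq_sqrt (hQ0pos t ht).le
    have hQQ : Q (0, t) = Q0 t := by simp [Q, Q0]
    have e1 : F' 0 t = (cosh (u t) * φ t * Q0 t ^ 2 +
        (sinh (u t) + lam) * (Q' (0, t) / 2) * Q0 t) / √(Q0 t) ^ 3 := by
      simp only [F', hQQ]
      rw [eq_div_iff (pow_ne_zero 3 hr0)]
      nth_rewrite 5 [← hsq]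
      nth_rewrite 4 [← hsq]
      simp only [zero_mul, add_zero]
      field_simp
    have e2 : H' t = (N' t * Q0 t - N t * (Q0' t / 2)) / √(Q0 t) ^ 3 := by
      simp only [H']
      rw [eq_div_iff (pow_ne_zero 3 hr0)]
      nth_rewrite 5 [← hsq]
      field_simp
    rw [e1, e2]
    simp only [E]
    rw [← add_div]
    congr 1
    simp only [Q0, Q', N', N, Q0', catenaryResidue, zero_mul, add_zero]
    rcases hε with rfl | rfl <;> ring
  have hint : ∫ t in a..b, F' 0 t = ∫ t in a..b, E t := by
    rw [intervalIntegral.integral_congr (g := fun t => E t + H' t)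
      (fun t ht => hsplit t (by rwa [uIcc_of_le hab.le] at ht)),
      intervalIntegral.integral_add (cE.intervalIntegrable_of_Icc hab.le)
        (cH'.intervalIntegrable_of_Icc hab.le), iH', add_zero]
  rw [hint] at key
  exact key

/-- The curve is critical exactly when its Euler–Lagrange expression vanishes. -/
theorem isCritical_iff_catenaryResidue_eq_zero {a b lam ε : ℝ} (hab : a < b) {u v : ℝ → ℝ}
    (hu : ContDiff ℝ (⊤ : ℕ∞) u) (hv : ContDiff ℝ (⊤ : ℕ∞) v) (hε : ε = 1 ∨ ε = -1)
    (hnd : ∀ t ∈ Set.Icc a b, 0 < ε * (deriv v t ^ 2 * cosh (u t) ^ 2 - deriv u t ^ 2)) :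
    IsCritical (fun x _ => sinh x + lam) ε u v a b ↔
      ∀ t ∈ Set.Icc a b, catenaryResidue lam u v t = 0 := by
  have hu1 := contDiff_deriv_of_contDiff_top hu
  have hv1 := contDiff_deriv_of_contDiff_top hv
  have hG := contDiff_catenaryResidue lam hu hv
  have cu := hu.continuous
  have cu1 := hu1.continuous
  have cv1 := hv1.continuous
  have cG := hG.continuous
  constructor
  · intro h
    let η : ℝ → ℝ := fun t => (t - a) * (b - t) * catenaryResidue lam u v t
    have hφ : ContDiff ℝ (⊤ : ℕ∞) (fun t => η t * deriv v t) := by unfold η; fun_prop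
    have hψ : ContDiff ℝ (⊤ : ℕ∞) (fun t => -(η t * deriv u t)) := by unfold η; fun_prop
    have h0 := h _ _ hφ hψ (by simp [η]) (by simp [η]) (by simp [η]) (by simp [η])
    rw [(hasDerivAt_catenary_energy hab hu hv hε hnd hφ hψ (by simp [η]) (by simp [η])
      (by simp [η]) (by simp [η])).deriv] at h0
    have hsq : ∀ t ∈ Set.Icc a b, 0 < deriv v t ^ 2 + deriv u t ^ 2 := by
      intro t ht
      by_contra hle
      have h1 : deriv v t ^ 2 = 0 := by nlinarith [sq_nonneg (deriv v t), sq_nonneg (deriv u t)]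
      have h2 : deriv u t ^ 2 = 0 := by nlinarith [sq_nonneg (deriv v t), sq_nonneg (deriv u t)]
      have := hnd t ht
      simp [h1, h2] at this
    have hr : ∀ t ∈ Set.Icc a b,
        0 < √(ε * (deriv v t ^ 2 * cosh (u t) ^ 2 - deriv u t ^ 2)) ^ 3 := fun t ht =>
      pow_pos (Real.sqrt_pos.2 (hnd t ht)) 3
    have hform : ∀ t, cosh (u t) * catenaryResidue lam u v t *
        (deriv v t * (η t * deriv v t) - deriv u t * -(η t * deriv u t)) /
          √(ε * (deriv v t ^ 2 * cosh (u t) ^ 2 - deriv u t ^ 2)) ^ 3 =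
        (t - a) * (b - t) * (cosh (u t) * (deriv v t ^ 2 + deriv u t ^ 2) /
          √(ε * (deriv v t ^ 2 * cosh (u t) ^ 2 - deriv u t ^ 2)) ^ 3) *
          catenaryResidue lam u v t ^ 2 := by
      intro t
      simp only [η]
      ring
    simp only [hform] at h0
    have hw : ∀ t ∈ Set.Icc a b, 0 < cosh (u t) * (deriv v t ^ 2 + deriv u t ^ 2) /
        √(ε * (deriv v t ^ 2 * cosh (u t) ^ 2 - deriv u t ^ 2)) ^ 3 := fun t ht =>
      div_pos (mul_pos (cosh_pos _) (hsq t ht)) (hr t ht)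
    have hIoo : Set.EqOn (catenaryResidue lam u v) (fun _ => 0) (Set.Ioo a b) := by
      intro c hc
      by_contra hne
      refine (intervalIntegral.integral_pos hab ?_ ?_ ⟨c, Set.Ioo_subset_Icc_self hc, ?_⟩).ne' h0
      · have h3 := fun t ht => (hr t ht).ne'
        fun_prop (disch := assumption)
      · intro t ht
        have := hw t (Set.Ioc_subset_Icc_self ht)
        exact mul_nonneg (mul_nonneg (mul_nonneg (sub_nonneg.2 ht.1.le) (sub_nonneg.2 ht.2))
          this.le) (sq_nonneg _)
      · have := hw c (Set.Ioo_subset_Icc_self hc)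
        exact mul_pos (mul_pos (mul_pos (sub_pos.2 hc.1) (sub_pos.2 hc.2)) this)
          (sq_pos_of_ne_zero hne)
    have hcl := hIoo.closure cG continuous_const
    rw [closure_Ioo hab.ne] at hcl
    exact hcl
  · intro h φ ψ hφ hψ hφa hφb hψa hψb
    rw [(hasDerivAt_catenary_energy hab hu hv hε hnd hφ hψ hφa hφb hψa hψb).deriv,
      intervalIntegral.integral_congr (g := fun _ => 0)]
    · simp
    · intro t ht
      rw [Set.uIcc_of_le hab.le] at ht
      simp [h t ht]

theorem hasDerivAt_Psi {u v : ℝ → ℝ} {u' v' t : ℝ} (hu : HasDerivAt u u' t)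
    (hv : HasDerivAt v v' t) :
    HasDerivAt (fun t => Psi (u t) (v t))
      ![sinh (u t) * u' * cos (v t) - cosh (u t) * sin (v t) * v',
        sinh (u t) * u' * sin (v t) + cosh (u t) * cos (v t) * v', cosh (u t) * u'] t := by
  rw [hasDerivAt_pi]
  intro i
  fin_cases i
  · exact (hu.cosh.mul hv.cos).congr_deriv (by
      simp
      ring)
  · exact (hu.cosh.mul hv.sin).congr_deriv (by
      simp
      ring)
  · exact hu.sinh

theorem deriv_deriv_Psi {u v : ℝ → ℝ} (hu : ContDiff ℝ (⊤ : ℕ∞) u)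
    (hv : ContDiff ℝ (⊤ : ℕ∞) v) (t : ℝ) :
    deriv (deriv fun t => Psi (u t) (v t)) t =
      ![(cosh (u t) * deriv u t ^ 2 + sinh (u t) * deriv (deriv u) t -
            cosh (u t) * deriv v t ^ 2) * cos (v t) -
          (2 * sinh (u t) * deriv u t * deriv v t + cosh (u t) * deriv (deriv v) t) * sin (v t),
        (cosh (u t) * deriv u t ^ 2 + sinh (u t) * deriv (deriv u) t -
            cosh (u t) * deriv v t ^ 2) * sin (v t) +
          (2 * sinh (u t) * deriv u t * deriv v t + cosh (u t) * deriv (deriv v) t) * cos (v t),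
        sinh (u t) * deriv u t ^ 2 + cosh (u t) * deriv (deriv u) t] := by
  have du := hasDerivAt_of_contDiff_top hu t
  have dv := hasDerivAt_of_contDiff_top hv t
  have du1 := hasDerivAt_of_contDiff_top (contDiff_deriv_of_contDiff_top hu) t
  have dv1 := hasDerivAt_of_contDiff_top (contDiff_deriv_of_contDiff_top hv) t
  rw [funext fun x => (hasDerivAt_Psi (hasDerivAt_of_contDiff_top hu x)
    (hasDerivAt_of_contDiff_top hv x)).deriv]
  refine HasDerivAt.deriv ?_
  rw [hasDerivAt_pi]
  intro i
  fin_cases i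
  · exact (((du.sinh.mul du1).mul dv.cos).sub ((du.cosh.mul dv.sin).mul dv1)).congr_deriv (by
      simp
      ring)
  · exact (((du.sinh.mul du1).mul dv.sin).add ((du.cosh.mul dv.cos).mul dv1)).congr_deriv (by
      simp
      ring)
  · exact (du.cosh.mul du1).congr_deriv (by
      simp
      ring)

theorem spherical_catenary_normal_characterization
    (a b lam : ℝ) (hab : a < b)
    (u v : ℝ → ℝ) (hu : ContDiff ℝ (⊤ : ℕ∞) u) (hv : ContDiff ℝ (⊤ : ℕ∞) v)
    (ε : ℝ) (hε : ε = 1 ∨ ε = -1)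
    (γ : ℝ → Fin 3 → ℝ) (hγ : ∀ t, γ t = Psi (u t) (v t))
    (sp : ℝ → ℝ)
    (hsp : ∀ t, sp t =
      Real.sqrt (ε * ((deriv v t) ^ 2 * Real.cosh (u t) ^ 2 - (deriv u t) ^ 2)))
    (hnd : ∀ t ∈ Set.Icc a b,
      0 < ε * ((deriv v t) ^ 2 * Real.cosh (u t) ^ 2 - (deriv u t) ^ 2))
    (κ : ℝ → ℝ)
    (hκ : ∀ t, κ t = ε * det3 (γ t) (deriv γ t) (deriv (deriv γ) t) / sp t ^ 3)
    (n : ℝ → Fin 3 → ℝ) (hn : ∀ t, n t = (-(1 / sp t)) • lcross (γ t) (deriv γ t))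
    (hd : ∀ t ∈ Set.Icc a b, 0 < Real.sinh (u t))
    (hne : ∀ t ∈ Set.Icc a b, Real.sinh (u t) + lam ≠ 0) :
    IsCritical (fun x _ => Real.sinh x + lam) ε u v a b ↔
      ∀ t ∈ Set.Icc a b,
        κ t = lprod (n t) ![(0 : ℝ), 0, 1] / (Real.sinh (u t) + lam) := by
  rw [isCritical_iff_catenaryResidue_eq_zero hab hu hv hε hnd]
  refine forall₂_congr fun t ht => ?_
  have hr : sp t ≠ 0 := by
    rw [hsp]
    exact (Real.sqrt_pos.2 (hnd t ht)).ne'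
  have hr2 : sp t ^ 2 = ε * (deriv v t ^ 2 * cosh (u t) ^ 2 - deriv u t ^ 2) := by
    rw [hsp]
    exact Real.sq_sqrt (hnd t ht).le
  have hP := hne t ht
  obtain rfl : γ = fun t => Psi (u t) (v t) := funext hγ
  have d1 := (hasDerivAt_Psi (hasDerivAt_of_contDiff_top hu t)
    (hasDerivAt_of_contDiff_top hv t)).deriv
  have hcs := Real.sin_sq_add_cos_sq (v t)
  have hch := Real.cosh_sq (u t)
  have hdet : det3 (Psi (u t) (v t)) (deriv (fun t => Psi (u t) (v t)) t)
      (deriv (deriv fun t => Psi (u t) (v t)) t) =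
      -(cosh (u t) * (deriv u t * deriv (deriv v) t - deriv v t * deriv (deriv u) t) +
        2 * deriv u t ^ 2 * deriv v t * sinh (u t) -
        deriv v t ^ 3 * sinh (u t) * cosh (u t) ^ 2) := by
    rw [d1, deriv_deriv_Psi hu hv]
    simp only [det3, Psi, Matrix.cons_val_zero, Matrix.cons_val_one, Matrix.cons_val]
    linear_combination (cosh (u t) ^ 2 * deriv v t *
        (sinh (u t) * deriv u t ^ 2 + cosh (u t) * deriv (deriv u) t) +
        (sinh (u t) ^ 2 - cosh (u t) ^ 2) * deriv u t *
          (2 * sinh (u t) * deriv u t * deriv v t + cosh (u t) * deriv (deriv v) t) -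
        sinh (u t) * cosh (u t) * deriv v t * (cosh (u t) * deriv u t ^ 2 +
          sinh (u t) * deriv (deriv u) t - cosh (u t) * deriv v t ^ 2)) * hcs +
      (deriv v t * deriv (deriv u) t * cosh (u t) - deriv u t *
        (2 * sinh (u t) * deriv u t * deriv v t + cosh (u t) * deriv (deriv v) t)) * hch
  have hz : lprod (n t) ![(0 : ℝ), 0, 1] = -(cosh (u t) ^ 2 * deriv v t) / sp t := by
    rw [hn, d1]
    simp only [lprod, lcross, Psi, Matrix.cons_val_zero, Matrix.cons_val_one, Matrix.cons_val,
      Pi.smul_apply, smul_eq_mul]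
    field_simp
    linear_combination (-(cosh (u t) ^ 2 * deriv v t)) * hcs
  rw [hκ, hdet, hz, div_div, div_eq_div_iff (pow_ne_zero 3 hr) (mul_ne_zero hr hP)]
  unfold catenaryResidue
  set K := cosh (u t) * (deriv u t * deriv (deriv v) t - deriv v t * deriv (deriv u) t) +
        2 * deriv u t ^ 2 * deriv v t * sinh (u t) -
        deriv v t ^ 3 * sinh (u t) * cosh (u t) ^ 2
  have hε0 : ε ≠ 0 := by rcases hε with rfl | rfl <;> norm_num
  have hdiff : ε * -K * (sp t * (sinh (u t) + lam)) -
      -(cosh (u t) ^ 2 * deriv v t) * sp t ^ 3 = ε * sp t *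
      (cosh (u t) ^ 2 * deriv v t * (deriv v t ^ 2 * cosh (u t) ^ 2 - deriv u t ^ 2) -
        (sinh (u t) + lam) * K) := by
    linear_combination (cosh (u t) ^ 2 * deriv v t * sp t) * hr2
  rw [← sub_eq_zero (a := ε * -K * _), hdiff, mul_eq_zero_iff_left (mul_ne_zero hε0 hr)]
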